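/- arXiv:2203.07192 — 2 statements merged into one kernel-verified Lean document; each statement's English description precedes it below -/
import Mathlib

section
/- (MDI-NEW reduces to the nonlinear witness for maximally entangled POVMs.) Let α and β be nonempty finite types with cardinalities d_A and d_B. Let W, H₁, H₂ be Hermitian matrices indexed by α × β and s > 0, with decompositions τ_s, ω_t, α_{st}, β_{st}, γ_{st} as in the decomposition assumption. Let Φ_A and Φ_B be the maximally entangled projectors on α × α and β × β respectively. For a density matrix ρ indexed by α × β, define P^{st} = tr((Φ_A ⊗ Φ_B)·M(τ_s, ρ, ω_t)) and P^{AB} = tr((Φ_A ⊗ Φ_B)·M((1/d_A)·1_α, ρ, (1/d_B)·1_β)). Then P^{AB} = 1/(d_A²·d_B²), and the MDI nonlinear witness value N := Σ_{s,t} α_{st}·P^{st} − (1/(s·d_A·d_B·P^{AB}))·[(Σ_{s,t} β_{st}·P^{st})² + (Σ_{s,t} γ_{st}·P^{st})²] equals (1/(d_A·d_B))·[tr(W·ρ) − (1/s)·((tr(H₁·ρ))² + (tr(H₂·ρ))²)]. -/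
open Matrix Kronecker BigOperators ComplexOrder

noncomputable section

/-- A density matrix: a positive semidefinite complex matrix with trace 1. -/
def IsDensity {n : Type*} [Fintype n] (ρ : Matrix n n ℂ) : Prop :=
  ρ.PosSemidef ∧ ρ.trace = 1

/-- A separable density matrix on a product index type. -/
def IsSepDensity {α β : Type*} [Fintype α] [Fintype β]
    (ρ : Matrix (α × β) (α × β) ℂ) : Prop :=
  ∃ (m : ℕ) (p : Fin m → ℝ) (σA : Fin m → Matrix α α ℂ) (σB : Fin m → Matrix β β ℂ),
    (∀ i, 0 ≤ p i) ∧ (∑ i, p i) = 1 ∧ (∀ i, IsDensity (σA i)) ∧ (∀ i, IsDensity (σB i)) ∧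
    ρ = ∑ i, (p i : ℂ) • (σA i ⊗ₖ σB i)

/-- A separable positive semidefinite operator: a finite sum of Kronecker products of
positive semidefinite matrices. -/
def IsSepPSD {α β : Type*} [Fintype α] [Fintype β]
    (ρ : Matrix (α × β) (α × β) ℂ) : Prop :=
  ∃ (m : ℕ) (C : Fin m → Matrix α α ℂ) (D : Fin m → Matrix β β ℂ),
    (∀ i, (C i).PosSemidef) ∧ (∀ i, (D i).PosSemidef) ∧ ρ = ∑ i, C i ⊗ₖ D i

/-- `Λa` is the Hilbert–Schmidt adjoint of `Λ`. -/
def IsHSAdjoint {n : Type*} [Fintype n]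
    (Λ Λa : Matrix n n ℂ →ₗ[ℂ] Matrix n n ℂ) : Prop :=
  ∀ M N : Matrix n n ℂ, (M * Λ N).trace = (Λa M * N).trace

/-- The operator `τ ⊗ ρ ⊗ ω` with Alice's two tensor factors and Bob's two tensor
factors grouped together. -/
def Mop {α β : Type*} (τ : Matrix α α ℂ) (ρ : Matrix (α × β) (α × β) ℂ)
    (ω : Matrix β β ℂ) : Matrix ((α × α) × (β × β)) ((α × α) × (β × β)) ℂ :=
  Matrix.of fun x y =>
    τ x.1.1 y.1.1 * ρ (x.1.2, x.2.1) (y.1.2, y.2.1) * ω x.2.2 y.2.2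

/-- Partial trace over the second tensor factor. -/
def ptr2 {α β : Type*} [Fintype β] (A : Matrix (α × β) (α × β) ℂ) : Matrix α α ℂ :=
  Matrix.of fun a a' => ∑ b, A (a, b) (a', b)

/-- Partial trace over the first tensor factor. -/
def ptr1 {α β : Type*} [Fintype α] (A : Matrix (α × β) (α × β) ℂ) : Matrix β β ℂ :=
  Matrix.of fun b b' => ∑ a, A (a, b) (a, b')

/-- Partial transpose on the second subsystem. -/
def ptB {α β : Type*} (M : Matrix (α × β) (α × β) ℂ) : Matrix (α × β) (α × β) ℂ :=
  Matrix.of fun x y => M (x.1, y.2) (y.1, x.2)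


/-- Contracting `τ ⊗ ρ ⊗ ω` with unnormalized maximally entangled operators, scaled by `p` and `q`,
gives `p * q` times the expectation value of `τᵀ ⊗ ωᵀ` in `ρ`. -/
theorem trace_maxEntangled_kronecker_mul_Mop {α β : Type*} [Fintype α] [DecidableEq α]
    [Fintype β] [DecidableEq β] (p q : ℂ) (τ : Matrix α α ℂ)
    (ρ : Matrix (α × β) (α × β) ℂ) (ω : Matrix β β ℂ) :
    ((Matrix.of (fun x y : α × α => if x.1 = x.2 ∧ y.1 = y.2 then p else 0) ⊗ₖ
      Matrix.of (fun x y : β × β => if x.1 = x.2 ∧ y.1 = y.2 then q else 0)) * Mop τ ρ ω).trace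
      = p * q * ((τᵀ ⊗ₖ ωᵀ) * ρ).trace := by
  simp only [Matrix.trace, Matrix.diag_apply, Matrix.mul_apply, Matrix.kroneckerMap_apply,
    Matrix.of_apply, Mop, Matrix.transpose_apply, Fintype.sum_prod_type, ite_and, ite_mul,
    mul_ite, zero_mul, mul_zero, Finset.sum_ite_irrel, Finset.sum_const_zero, Finset.sum_ite_eq,
    Finset.mem_univ, if_true, Finset.mul_sum]
  refine Finset.sum_congr rfl fun i _ => Finset.sum_congr rfl fun j _ =>
    Finset.sum_congr rfl fun i' _ => Finset.sum_congr rfl fun j' _ => ?_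
  ring

/-- Linearity of the trace pairing with `ρ` over a doubly indexed combination. -/
theorem trace_sum_sum_smul_mul {n S T : Type*} [Fintype n] [Fintype S] [Fintype T]
    (f : S → T → ℂ) (A : S → T → Matrix n n ℂ) (ρ : Matrix n n ℂ) :
    ((∑ s, ∑ t, f s t • A s t) * ρ).trace = ∑ s, ∑ t, f s t * (A s t * ρ).trace := by
  simp only [Finset.sum_mul, Matrix.trace_sum, Matrix.smul_mul, Matrix.trace_smul, smul_eq_mul]

/-- With maximally entangled POVM elements, `P^{AB} = 1/(d_A²·d_B²)` and
the MDI nonlinear witness value equals `(1/(d_A·d_B))·[tr(W·ρ) − (1/s)·(tr(H₁·ρ)² + tr(H₂·ρ)²)]`. -/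
theorem mdinew_reduces_to_new
    {α β : Type*} [Fintype α] [DecidableEq α] [Nonempty α]
    [Fintype β] [DecidableEq β] [Nonempty β]
    (W H₁ H₂ : Matrix (α × β) (α × β) ℂ) (sX : ℝ)
    (hW : W.IsHermitian) (hH₁ : H₁.IsHermitian) (hH₂ : H₂.IsHermitian) (hsX : 0 < sX)
    {S T : Type*} [Fintype S] [Fintype T]
    (τ : S → Matrix α α ℂ) (ω : T → Matrix β β ℂ)
    (hτ : ∀ s, IsDensity (τ s)) (hω : ∀ t, IsDensity (ω t))
    (a b c : S → T → ℝ)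
    (hWd : W = ∑ s, ∑ t, (a s t : ℂ) • ((τ s)ᵀ ⊗ₖ (ω t)ᵀ))
    (hH₁d : H₁ = ∑ s, ∑ t, (b s t : ℂ) • ((τ s)ᵀ ⊗ₖ (ω t)ᵀ))
    (hH₂d : H₂ = ∑ s, ∑ t, (c s t : ℂ) • ((τ s)ᵀ ⊗ₖ (ω t)ᵀ))
    (ΦA : Matrix (α × α) (α × α) ℂ) (ΦB : Matrix (β × β) (β × β) ℂ)
    (hΦA : ΦA = Matrix.of (fun x y : α × α =>
        if x.1 = x.2 ∧ y.1 = y.2 then (1 / (Fintype.card α : ℂ)) else 0))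
    (hΦB : ΦB = Matrix.of (fun x y : β × β =>
        if x.1 = x.2 ∧ y.1 = y.2 then (1 / (Fintype.card β : ℂ)) else 0))
    (ρ : Matrix (α × β) (α × β) ℂ) (hρ : IsDensity ρ)
    (PAB : ℂ)
    (hPAB : PAB = ((ΦA ⊗ₖ ΦB) *
      Mop (((Fintype.card α : ℂ))⁻¹ • (1 : Matrix α α ℂ)) ρ
          (((Fintype.card β : ℂ))⁻¹ • (1 : Matrix β β ℂ))).trace) :
    PAB = 1 / ((Fintype.card α : ℂ) ^ 2 * (Fintype.card β : ℂ) ^ 2) ∧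
    (∑ s, ∑ t, (a s t : ℂ) * ((ΦA ⊗ₖ ΦB) * Mop (τ s) ρ (ω t)).trace)
      - (1 / ((sX : ℂ) * (Fintype.card α : ℂ) * (Fintype.card β : ℂ) * PAB)) *
        ((∑ s, ∑ t, (b s t : ℂ) * ((ΦA ⊗ₖ ΦB) * Mop (τ s) ρ (ω t)).trace) ^ 2
          + (∑ s, ∑ t, (c s t : ℂ) * ((ΦA ⊗ₖ ΦB) * Mop (τ s) ρ (ω t)).trace) ^ 2)
      = (1 / ((Fintype.card α : ℂ) * (Fintype.card β : ℂ))) *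
          ((W * ρ).trace - (1 / (sX : ℂ)) *
            (((H₁ * ρ).trace) ^ 2 + ((H₂ * ρ).trace) ^ 2)) := by
  have hA : (Fintype.card α : ℂ) ≠ 0 := Nat.cast_ne_zero.mpr Fintype.card_ne_zero
  have hB : (Fintype.card β : ℂ) ≠ 0 := Nat.cast_ne_zero.mpr Fintype.card_ne_zero
  have hs : (sX : ℂ) ≠ 0 := Complex.ofReal_ne_zero.mpr hsX.ne'
  have key : ∀ σ υ, ((ΦA ⊗ₖ ΦB) * Mop σ ρ υ).trace =
      1 / (Fintype.card α : ℂ) * (1 / (Fintype.card β : ℂ)) * ((σᵀ ⊗ₖ υᵀ) * ρ).trace := by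
    intro σ υ
    rw [hΦA, hΦB]
    exact trace_maxEntangled_kronecker_mul_Mop _ _ σ ρ υ
  have hP : PAB = 1 / ((Fintype.card α : ℂ) ^ 2 * (Fintype.card β : ℂ) ^ 2) := by
    rw [hPAB, key]
    simp only [Matrix.transpose_smul, Matrix.transpose_one, Matrix.smul_kronecker,
      Matrix.kronecker_smul, Matrix.one_kronecker_one, Matrix.smul_mul, Matrix.one_mul,
      Matrix.trace_smul, hρ.2, smul_eq_mul]
    field_simp
  have hsum : ∀ f : S → T → ℝ,
      ∑ s, ∑ t, (f s t : ℂ) * ((ΦA ⊗ₖ ΦB) * Mop (τ s) ρ (ω t)).trace =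
        1 / (Fintype.card α : ℂ) * (1 / (Fintype.card β : ℂ)) *
          ((∑ s, ∑ t, (f s t : ℂ) • ((τ s)ᵀ ⊗ₖ (ω t)ᵀ)) * ρ).trace := by
    intro f
    simp only [trace_sum_sum_smul_mul, key, Finset.mul_sum]
    exact Finset.sum_congr rfl fun s _ => Finset.sum_congr rfl fun t _ => mul_left_comm _ _ _
  refine ⟨hP, ?_⟩
  rw [hsum, hsum, hsum, ← hWd, ← hH₁d, ← hH₂d, hP]
  field_simp

end
end

section
/- (Measurement-device independence of the linear witness.) Let α and β be nonempty finite types. Let W be a Hermitian matrix indexed by α × β such that tr(W·σ') ≥ 0 for every separable density matrix σ' indexed by α × β, and suppose W = Σ_{s,t} α_{st}·τ_s^T ⊗ ω_t^T for a finite family of density matrices τ_s indexed by α, ω_t indexed by β and real coefficients α_{st}. Let σ be a separable density matrix indexed by α × β, and let A₁ (indexed by α × α) and B₁ (indexed by β × β) be positive semidefinite matrices (arbitrary dichotomic POVM elements). Then the MDI entanglement witness value I_α := Σ_{s,t} α_{st}·tr((A₁ ⊗ B₁)·M(τ_s, σ, ω_t)) is a nonnegative real number. -/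
open Matrix Kronecker BigOperators ComplexOrder

noncomputable section

/-- The operator obtained from `A` by contracting its second tensor factor with the state `σ`. -/
def contractSnd {α β : Type*} [Fintype β] (A : Matrix (α × β) (α × β) ℂ) (σ : Matrix β β ℂ) :
    Matrix α α ℂ :=
  Matrix.of fun a a' => ∑ b, ∑ b', A (a', b) (a, b') * σ b' b

theorem contractSnd_posSemidef {α β : Type*} [Fintype α] [Fintype β]
    {A : Matrix (α × β) (α × β) ℂ} {σ : Matrix β β ℂ}
    (hA : A.PosSemidef) (hσ : σ.PosSemidef) : (contractSnd A σ).PosSemidef := by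
  classical
  have hE : (A ⊙ (vecMulVec (1 : α → ℂ) (star 1) ⊗ₖ σᵀ)).PosSemidef :=
    hA.hadamard ((posSemidef_vecMulVec_self_star 1).kronecker hσ.transpose)
  let V : Matrix (α × β) α ℂ := Matrix.of fun p a => if p.1 = a then 1 else 0
  have hV : contractSnd A σ = (Vᴴ * (A ⊙ (vecMulVec (1 : α → ℂ) (star 1) ⊗ₖ σᵀ)) * V)ᵀ := by
    ext a a'
    simp only [contractSnd, V, of_apply, transpose_apply, mul_apply, conjTranspose_apply,
      hadamard_apply, kroneckerMap_apply, vecMulVec_apply, Fintype.sum_prod_type]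
    simp [apply_ite star, Finset.sum_ite_irrel]
    rw [Finset.sum_comm]
  rw [hV]
  exact (hE.conjTranspose_mul_mul_same V).transpose

theorem trace_mul_kronecker_eq_contractSnd {α β : Type*} [Fintype α] [Fintype β]
    (A : Matrix (α × β) (α × β) ℂ) (τ : Matrix α α ℂ) (σ : Matrix β β ℂ) :
    (A * (τ ⊗ₖ σ)).trace = (τᵀ * contractSnd A σ).trace := by
  simp only [trace, diag_apply, mul_apply, contractSnd, Fintype.sum_prod_type, of_apply,
    kroneckerMap_apply, transpose_apply, Finset.mul_sum]
  refine Finset.sum_congr rfl fun a _ => ?_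
  rw [Finset.sum_comm]
  refine Finset.sum_congr rfl fun a' _ => Finset.sum_congr rfl fun b _ =>
    Finset.sum_congr rfl fun b' _ => ?_
  ring

theorem trace_mul_kronecker_swap {α β : Type*} [Fintype α] [Fintype β]
    (B : Matrix (α × β) (α × β) ℂ) (σ : Matrix α α ℂ) (ω : Matrix β β ℂ) :
    (B * (σ ⊗ₖ ω)).trace = (B.submatrix Prod.swap Prod.swap * (ω ⊗ₖ σ)).trace := by
  simp only [trace, diag_apply, mul_apply]
  refine Fintype.sum_equiv (Equiv.prodComm α β) _ _ fun x =>
    Fintype.sum_equiv (Equiv.prodComm α β) _ _ fun y => ?_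
  simp [mul_comm (σ _ _)]

theorem Mop_sum_smul_kronecker {α β ι : Type*} [Fintype ι] (τ : Matrix α α ℂ) (ω : Matrix β β ℂ)
    (p : ι → ℂ) (C : ι → Matrix α α ℂ) (D : ι → Matrix β β ℂ) :
    Mop τ (∑ i, p i • (C i ⊗ₖ D i)) ω = ∑ i, p i • ((τ ⊗ₖ C i) ⊗ₖ (D i ⊗ₖ ω)) := by
  ext x y
  simp only [Mop, of_apply, Matrix.sum_apply, Matrix.smul_apply, kroneckerMap_apply, smul_eq_mul,
    Finset.mul_sum, Finset.sum_mul]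
  exact Finset.sum_congr rfl fun i _ => by ring

theorem Matrix.PosSemidef.isDensity_inv_trace_smul {n : Type*} [Fintype n] {X : Matrix n n ℂ}
    (hX : X.PosSemidef) (h : X.trace ≠ 0) : IsDensity (X.trace⁻¹ • X) :=
  ⟨hX.smul (inv_nonneg_of_nonneg hX.trace_nonneg), by simp [trace_smul, h]⟩

/-- A witness that is nonnegative on separable states is nonnegative on product positive
operators. -/
theorem trace_mul_kronecker_nonneg {α β : Type*} [Fintype α] [Fintype β]
    {W : Matrix (α × β) (α × β) ℂ}
    (hEW : ∀ σ' : Matrix (α × β) (α × β) ℂ, IsSepDensity σ' → 0 ≤ (W * σ').trace)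
    {X : Matrix α α ℂ} {Y : Matrix β β ℂ} (hX : X.PosSemidef) (hY : Y.PosSemidef) :
    0 ≤ (W * (X ⊗ₖ Y)).trace := by
  by_cases hX0 : X.trace = 0
  · simp [hX.trace_eq_zero_iff.mp hX0]
  by_cases hY0 : Y.trace = 0
  · simp [hY.trace_eq_zero_iff.mp hY0]
  have h := hEW ((X.trace⁻¹ • X) ⊗ₖ (Y.trace⁻¹ • Y))
    ⟨1, fun _ => 1, fun _ => X.trace⁻¹ • X, fun _ => Y.trace⁻¹ • Y, by simp, by simp,
      fun _ => hX.isDensity_inv_trace_smul hX0, fun _ => hY.isDensity_inv_trace_smul hY0,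
      by simp⟩
  have h' := mul_nonneg (mul_nonneg hX.trace_nonneg hY.trace_nonneg) h
  convert h' using 1
  simp only [smul_kronecker, kronecker_smul, Matrix.mul_smul, trace_smul, smul_eq_mul]
  field_simp

/-- Measurement-device independence of the linear witness: for any
separable shared state and any positive semidefinite POVM elements, the MDI-EW value is a
nonnegative real number. -/
theorem mdiew_nonneg_on_separable
    {α β : Type*} [Fintype α] [DecidableEq α] [Nonempty α]
    [Fintype β] [DecidableEq β] [Nonempty β]
    (W : Matrix (α × β) (α × β) ℂ) (hW : W.IsHermitian)
    (hEW : ∀ σ' : Matrix (α × β) (α × β) ℂ, IsSepDensity σ' → 0 ≤ (W * σ').trace)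
    {S T : Type*} [Fintype S] [Fintype T]
    (τ : S → Matrix α α ℂ) (ω : T → Matrix β β ℂ)
    (hτ : ∀ s, IsDensity (τ s)) (hω : ∀ t, IsDensity (ω t))
    (a : S → T → ℝ)
    (hWd : W = ∑ s, ∑ t, (a s t : ℂ) • ((τ s)ᵀ ⊗ₖ (ω t)ᵀ))
    (σ : Matrix (α × β) (α × β) ℂ) (hσ : IsSepDensity σ)
    (A₁ : Matrix (α × α) (α × α) ℂ) (B₁ : Matrix (β × β) (β × β) ℂ)
    (hA₁ : A₁.PosSemidef) (hB₁ : B₁.PosSemidef) :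
    0 ≤ ∑ s, ∑ t, (a s t : ℂ) * ((A₁ ⊗ₖ B₁) * Mop (τ s) σ (ω t)).trace := by
  obtain ⟨m, p, C, D, hp, -, hC, hD, rfl⟩ := hσ
  let X i := contractSnd A₁ (C i)
  let Y i := contractSnd (B₁.submatrix Prod.swap Prod.swap) (D i)
  have key : ∑ s, ∑ t, (a s t : ℂ) * ((A₁ ⊗ₖ B₁) *
      Mop (τ s) (∑ i, (p i : ℂ) • (C i ⊗ₖ D i)) (ω t)).trace =
      ∑ i, (p i : ℂ) * (W * (X i ⊗ₖ Y i)).trace := by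
    simp only [hWd, Mop_sum_smul_kronecker, Matrix.sum_mul, trace_sum,
      Matrix.mul_smul, Matrix.smul_mul, trace_smul, ← mul_kronecker_mul, trace_kronecker,
      smul_eq_mul, Finset.mul_sum, trace_mul_kronecker_swap B₁,
      trace_mul_kronecker_eq_contractSnd, X, Y]
    simp only [Finset.sum_comm (s := (Finset.univ : Finset T)) (t := (Finset.univ : Finset (Fin m)))]
    rw [Finset.sum_comm]
    refine Finset.sum_congr rfl fun i _ => Finset.sum_congr rfl fun s _ =>
      Finset.sum_congr rfl fun t _ => ?_
    ring
  rw [key]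
  refine Finset.sum_nonneg fun i _ => mul_nonneg (by exact_mod_cast hp i) ?_
  exact trace_mul_kronecker_nonneg hEW (contractSnd_posSemidef hA₁ (hC i).1)
    (contractSnd_posSemidef (hB₁.submatrix _) (hD i).1)

end
end
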